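/- Let R be a commutative ring, let a, b, c, m be natural numbers, and let F be a b×a matrix and G a c×b matrix with entries in R such that G * F = 0. For each prime ideal P of R, let F(P) and G(P) denote the matrices over the residue field κ(P) obtained by applying the canonical ring homomorphism R → κ(P) to each entry. Then the set of primes P ∈ Spec R such that rank F(P) + rank G(P) ≤ b − m (equivalently, such that the κ(P)-dimension of the middle homology ker G(P)/im F(P) of the base-changed complex is at least m) is a Zariski-closed subset of the prime spectrum of R. -/

import Mathlib

/-- The canonical ring homomorphism from `R` to the residue field `κ(P)` of the
localization of `R` at the prime ideal `P`. -/
noncomputable def residueFieldMap {R : Type*} [CommRing R] (P : PrimeSpectrum R) :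
    R →+* IsLocalRing.ResidueField (Localization.AtPrime P.asIdeal) :=
  (IsLocalRing.residue (Localization.AtPrime P.asIdeal)).comp
    (algebraMap R (Localization.AtPrime P.asIdeal))

theorem residueFieldMap_eq_zero_iff {R : Type*} [CommRing R] (P : PrimeSpectrum R) (x : R) :
    residueFieldMap P x = 0 ↔ x ∈ P.asIdeal := by
  rw [residueFieldMap, RingHom.comp_apply, IsLocalRing.residue_eq_zero_iff]
  exact IsLocalization.AtPrime.to_map_mem_maximal_iff _ _ _

/-- Over a field, some `M.rank` rows of `M` are linearly independent. -/
theorem exists_linearIndependent_row_submatrix {K m n : Type*} [Field K] [Finite m] [Fintype n]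
    (M : Matrix m n K) :
    ∃ f : Fin M.rank → m, LinearIndependent K (M.submatrix f id).row := by
  rw [M.rank_eq_finrank_span_row]
  obtain ⟨v, hv, -, hli⟩ := Submodule.exists_fun_fin_finrank_span_eq K (Set.range M.row)
  choose f hf using hv
  obtain rfl : (fun i ↦ M.row (f i)) = v := funext hf
  exact ⟨f, hli⟩

/-- A matrix over a field has a nonvanishing minor of size its rank. -/
theorem exists_submatrix_det_ne_zero {K m n : Type*} [Field K] [Finite m] [Fintype n]
    (M : Matrix m n K) :
    ∃ (f : Fin M.rank → m) (g : Fin M.rank → n), (M.submatrix f g).det ≠ 0 := by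
  obtain ⟨f, hf⟩ := exists_linearIndependent_row_submatrix M
  have hcols := exists_linearIndependent_row_submatrix (M.submatrix f id).transpose
  have hr : (M.submatrix f id).transpose.rank = M.rank := by
    rw [Matrix.rank_transpose, hf.rank_matrix, Fintype.card_fin]
  rw [hr] at hcols
  obtain ⟨g, hg⟩ := hcols
  refine ⟨f, g, ?_⟩
  have hu := (Matrix.isUnit_iff_isUnit_det _).1 (Matrix.linearIndependent_rows_iff_isUnit.1 hg)
  rw [← Matrix.det_transpose]
  exact hu.ne_zero

/-- The rank of a matrix at the residue fields is a lower semicontinuous function on `Spec R`. -/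
theorem lowerSemicontinuous_rank_residueFieldMap {R m n : Type*} [CommRing R] [Finite m]
    [Fintype n] (M : Matrix m n R) :
    LowerSemicontinuous fun P : PrimeSpectrum R ↦ (M.map (residueFieldMap P)).rank := by
  intro P y hy
  obtain ⟨f, g, hfg⟩ := exists_submatrix_det_ne_zero (M.map (residueFieldMap P))
  have hdet (Q : PrimeSpectrum R) : ((M.map (residueFieldMap Q)).submatrix f g).det =
      residueFieldMap Q (M.submatrix f g).det := by
    rw [RingHom.map_det]; rfl
  rw [hdet, Ne, residueFieldMap_eq_zero_iff] at hfg
  filter_upwards [(PrimeSpectrum.basicOpen (M.submatrix f g).det).isOpen.mem_nhds hfg] with Q hQ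
  have hQ' : ((M.map (residueFieldMap Q)).submatrix f g).det ≠ 0 := by
    rwa [hdet, Ne, residueFieldMap_eq_zero_iff]
  have hle := Matrix.rank_submatrix_le (M.map (residueFieldMap Q)) f g
  rw [Matrix.rank_of_det_ne_zero hQ', Fintype.card_fin] at hle
  exact hy.trans_le hle

/-- For matrices `F : b × a` and `G : c × b` over a commutative ring `R` with `G * F = 0`,
the locus of primes `P` where `rank F(P) + rank G(P) ≤ b - m` (equivalently, where the
middle homology of the base-changed complex has dimension at least `m` over `κ(P)`)
is Zariski-closed in `Spec R`. -/
theorem rank_jumping_locus_isClosed {R : Type*} [CommRing R] (a b c m : ℕ)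
    (F : Matrix (Fin b) (Fin a) R) (G : Matrix (Fin c) (Fin b) R)
    (hGF : G * F = 0) :
    IsClosed {P : PrimeSpectrum R |
      ((F.map (residueFieldMap P)).rank : ℤ) + ((G.map (residueFieldMap P)).rank : ℤ)
        ≤ (b : ℤ) - (m : ℤ)} := by
  have h := (lowerSemicontinuous_rank_residueFieldMap F).add
    (lowerSemicontinuous_rank_residueFieldMap G)
  rcases le_or_gt m b with hm | hm
  · convert h.isClosed_preimage (b - m) using 1
    ext P
    simp only [Set.mem_ofPred_eq, Set.mem_preimage, Set.mem_Iic]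
    omega
  · convert isClosed_empty using 1
    ext P
    simp only [Set.mem_ofPred_eq, Set.mem_empty_iff_false, iff_false]
    omega
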